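/- arXiv:1001.1510 — 3 statements merged into one kernel-verified Lean document; each statement's English description precedes it below -/
import Mathlib

section
/- Let d ∈ (0,n], β ∈ [1,∞), λ ∈ (0,∞), and let ω be a nonnegative Borel function on ℝⁿ×(0,∞). Define the aperture-β nontangential maximal function N_βω(x) := sup{ω(y,t) : y ∈ ℝⁿ, t > 0, |y−x| < βt}. Then H^d({x ∈ ℝⁿ : N_βω(x) > λ}) ≤ C β^d H^d({x ∈ ℝⁿ : Nω(x) > λ}), where C is a positive constant depending only on n and independent of β, ω, λ and d. -/
open MeasureTheory Metric Set
open scoped ENNReal NNReal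

noncomputable section

/-- The `d`-dimensional Hausdorff capacity of `E ⊆ ℝⁿ`. -/
def Hcap (n : ℕ) (d : ℝ) (E : Set (EuclideanSpace ℝ (Fin n))) : ℝ≥0∞ :=
  ⨅ (c : ℕ → EuclideanSpace ℝ (Fin n) × ℝ≥0) (_ : E ⊆ ⋃ j, ball (c j).1 (c j).2),
    ∑' j, ((c j).2 : ℝ≥0∞) ^ d

/-- The nontangential maximal function of `ω : ℝⁿ × (0,∞) → [0,∞]`. -/
def ntMax (n : ℕ) (ω : EuclideanSpace ℝ (Fin n) → ℝ → ℝ≥0∞)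
    (x : EuclideanSpace ℝ (Fin n)) : ℝ≥0∞ :=
  ⨆ (y : EuclideanSpace ℝ (Fin n)) (t : ℝ) (_ : 0 < t) (_ : dist y x < t), ω y t

/-- The Choquet integral of `f` against the `d`-dimensional Hausdorff capacity. -/
def choquet (n : ℕ) (d : ℝ) (f : EuclideanSpace ℝ (Fin n) → ℝ≥0∞) : ℝ≥0∞ :=
  ∫⁻ lam in Ioi (0:ℝ), Hcap n d {x | ENNReal.ofReal lam < f x}


/-- The aperture-`β` nontangential maximal function. -/
def ntMaxA (n : ℕ) (β : ℝ) (ω : EuclideanSpace ℝ (Fin n) → ℝ → ℝ≥0∞)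
    (x : EuclideanSpace ℝ (Fin n)) : ℝ≥0∞ :=
  ⨆ (y : EuclideanSpace ℝ (Fin n)) (t : ℝ) (_ : 0 < t) (_ : dist y x < β * t), ω y t

theorem Hcap_le_of_countable (n : ℕ) (d : ℝ) (hd : 0 < d) {ι : Type*} [Countable ι]
    (E : Set (EuclideanSpace ℝ (Fin n))) (x : ι → EuclideanSpace ℝ (Fin n)) (r : ι → ℝ≥0)
    (hE : E ⊆ ⋃ i, ball (x i) (r i)) :
    Hcap n d E ≤ ∑' i, (r i : ℝ≥0∞) ^ d := by
  obtain ⟨f, hf⟩ := exists_injective_nat ι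
  let c : ℕ → EuclideanSpace ℝ (Fin n) × ℝ≥0 :=
    Function.extend f (fun i => (x i, r i)) (fun _ => (0, 0))
  have hc : ∀ i, c (f i) = (x i, r i) := fun i => hf.extend_apply _ _ i
  have hcov : E ⊆ ⋃ j, ball (c j).1 (c j).2 := by
    intro z hz
    obtain ⟨i, hi⟩ := mem_iUnion.1 (hE hz)
    refine mem_iUnion.2 ⟨f i, ?_⟩
    rw [hc]
    exact hi
  refine (iInf₂_le c hcov).trans (le_of_eq ?_)
  have hs : Function.support (fun j => ((c j).2 : ℝ≥0∞) ^ d) ⊆ Set.range f := by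
    intro j hj
    by_contra hne
    apply hj
    have : c j = (0, 0) := Function.extend_apply' _ _ _ (by simpa using hne)
    simp [this, hd]
  rw [← hf.tsum_eq hs]
  simp [hc]

theorem ball_content (n : ℕ) (d : ℝ) (hd : 0 < d) (hdn : d ≤ n) {ι : Type*} [Countable ι]
    (y : EuclideanSpace ℝ (Fin n)) (t : ℝ≥0) (ht : 0 < t)
    (x : ι → EuclideanSpace ℝ (Fin n)) (r : ι → ℝ≥0) (hr : ∀ i, r i ≤ t)
    (hE : ball y t ⊆ ⋃ i, ball (x i) (r i)) :
    (t : ℝ≥0∞) ^ d ≤ ∑' i, (r i : ℝ≥0∞) ^ d := by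
  have ht0 : (t : ℝ≥0∞) ≠ 0 := by exact_mod_cast ht.ne'
  have htt : (t : ℝ≥0∞) ≠ ∞ := ENNReal.coe_ne_top
  set v := volume (ball (0 : EuclideanSpace ℝ (Fin n)) 1) with hv
  have hv0 : v ≠ 0 := (measure_ball_pos _ _ one_pos).ne'
  have hvt : v ≠ ∞ := measure_ball_lt_top.ne
  have hb : ∀ (z : EuclideanSpace ℝ (Fin n)) (s : ℝ≥0),
      volume (ball z s) ≤ (s : ℝ≥0∞) ^ (n : ℝ) * v ∧
      (0 < s → volume (ball z s) = (s : ℝ≥0∞) ^ (n : ℝ) * v) := by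
    intro z s
    have key : 0 < s → volume (ball z s) = (s : ℝ≥0∞) ^ (n : ℝ) * v := by
      intro hs
      rw [Measure.addHaar_ball_of_pos _ _ (by exact_mod_cast hs)]
      simp [ENNReal.ofReal_pow, ENNReal.rpow_natCast, hv]
    refine ⟨?_, key⟩
    rcases eq_or_lt_of_le (bot_le : (0 : ℝ≥0) ≤ s) with h | h
    · subst h
      simp
    · exact (key h).le
  have h1 : (t : ℝ≥0∞) ^ (n : ℝ) * v ≤ (∑' i, (r i : ℝ≥0∞) ^ (n : ℝ)) * v := by
    rw [← (hb y t).2 ht, ← ENNReal.tsum_mul_right]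
    exact (measure_mono hE).trans ((measure_iUnion_le _).trans
      (ENNReal.tsum_le_tsum fun i => (hb _ _).1))
  have h2 : (t : ℝ≥0∞) ^ (n : ℝ) ≤ ∑' i, (r i : ℝ≥0∞) ^ (n : ℝ) :=
    (ENNReal.mul_le_mul_iff_left hv0 hvt).1 h1
  have h3 : ∀ i, (r i : ℝ≥0∞) ^ (n : ℝ) ≤ (t : ℝ≥0∞) ^ ((n : ℝ) - d) * (r i : ℝ≥0∞) ^ d := by
    intro i
    have : (r i : ℝ≥0∞) ^ (n : ℝ) = (r i : ℝ≥0∞) ^ ((n : ℝ) - d) * (r i : ℝ≥0∞) ^ d := by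
      rw [← ENNReal.rpow_add_of_nonneg _ _ (by linarith) hd.le]
      simp
    rw [this]
    gcongr
    exact hr i
  have h4 : (t : ℝ≥0∞) ^ (n : ℝ) = (t : ℝ≥0∞) ^ ((n : ℝ) - d) * (t : ℝ≥0∞) ^ d := by
    rw [← ENNReal.rpow_add_of_nonneg _ _ (by linarith) hd.le]
    simp
  have h5 := h2.trans (ENNReal.tsum_le_tsum h3)
  rw [h4, ENNReal.tsum_mul_left] at h5
  refine (ENNReal.mul_le_mul_iff_right ?_ ?_).1 h5
  · exact (ENNReal.rpow_pos (pos_iff_ne_zero.2 ht0) htt).ne'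
  · exact ENNReal.rpow_ne_top_of_nonneg (by linarith) htt

theorem cover_bound (n : ℕ) (d : ℝ) (hd : 0 < d) (hdn : d ≤ n) (β : ℝ≥0) (hβ : 1 ≤ β)
    (F : Set (EuclideanSpace ℝ (Fin n) × ℝ≥0)) (hF : ∀ p ∈ F, 0 < p.2)
    (c : ℕ → EuclideanSpace ℝ (Fin n) × ℝ≥0)
    (hc : ∀ p ∈ F, ball p.1 p.2 ⊆ ⋃ j, ball (c j).1 (c j).2)
    (hS : ∑' j, ((c j).2 : ℝ≥0∞) ^ d ≠ ∞) :
    Hcap n d (⋃ p ∈ F, ball p.1 (β * p.2)) ≤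
      (3 ^ (n : ℝ) + 11 ^ (n : ℝ)) * (β : ℝ≥0∞) ^ d * ∑' j, ((c j).2 : ℝ≥0∞) ^ d := by
  set S := ∑' j, ((c j).2 : ℝ≥0∞) ^ d with hSdef
  have hβ' : (1 : ℝ) ≤ β := by exact_mod_cast hβ
  let J : EuclideanSpace ℝ (Fin n) × ℝ≥0 → Set ℕ := fun p =>
    {j | (ball (c j).1 (c j).2 ∩ ball p.1 p.2).Nonempty}
  let G : Set (EuclideanSpace ℝ (Fin n) × ℝ≥0) := {p ∈ F | ∀ j ∈ J p, (c j).2 < p.2}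
  have hG1 : ∀ p ∈ G, (p.2 : ℝ≥0∞) ^ d ≤ ∑' j : J p, ((c j).2 : ℝ≥0∞) ^ d := by
    intro p hp
    refine ball_content n d hd hdn p.1 p.2 (hF p hp.1) (fun j : J p => (c j).1)
      (fun j => (c j).2) (fun j => (hp.2 j j.2).le) ?_
    intro z hz
    obtain ⟨j, hj⟩ := mem_iUnion.1 (hc p hp.1 hz)
    exact mem_iUnion.2 ⟨⟨j, ⟨z, hj, hz⟩⟩, hj⟩
  have hG2 : ∀ p ∈ G, (p.2 : ℝ) ≤ (S ^ (1 / d)).toReal := by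
    intro p hp
    have h := (hG1 p hp).trans (ENNReal.tsum_comp_le_tsum_of_injective
      (Subtype.val_injective) (fun j => ((c j).2 : ℝ≥0∞) ^ d))
    have h' : (p.2 : ℝ≥0∞) ≤ S ^ (1 / d) := by
      rw [one_div]
      exact (ENNReal.le_rpow_inv_iff hd).2 h
    have := ENNReal.toReal_mono (ENNReal.rpow_ne_top_of_nonneg (by positivity) hS) h'
    simpa using this
  obtain ⟨u, huG, hud, hu⟩ := Vitali.exists_disjoint_subfamily_covering_enlargement
    (fun p : EuclideanSpace ℝ (Fin n) × ℝ≥0 => ball p.1 (3 * p.2)) G (fun p => (p.2 : ℝ)) 2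
    (by norm_num) (fun p _ => p.2.2) _ hG2
    (fun p hp => ⟨p.1, by
      have : (0 : ℝ) < p.2 := by exact_mod_cast hF p hp.1
      simpa using this⟩)
  have hucount : u.Countable := by
    refine hud.countable_of_isOpen (fun p _ => isOpen_ball) (fun p hp => ⟨p.1, by
      have : (0 : ℝ) < p.2 := by exact_mod_cast hF p (huG hp).1
      simpa using this⟩)
  have : Countable u := hucount.to_subtype
  have hsum : ∑' p : u, ((p : EuclideanSpace ℝ (Fin n) × ℝ≥0).2 : ℝ≥0∞) ^ d ≤ S := by
    calc _ ≤ ∑' p : u, ∑' j : J p, ((c j).2 : ℝ≥0∞) ^ d :=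
          ENNReal.tsum_le_tsum fun p => hG1 p (huG p.2)
      _ = ∑' q : (Σ p : u, J p), ((c q.2).2 : ℝ≥0∞) ^ d :=
          (ENNReal.tsum_sigma' (fun q : (Σ p : u, J p) => ((c q.2).2 : ℝ≥0∞) ^ d)).symm
      _ ≤ S := by
          refine ENNReal.tsum_comp_le_tsum_of_injective (f := fun q : (Σ p : u, J p) => (q.2 : ℕ))
            ?_ (fun j => ((c j).2 : ℝ≥0∞) ^ d)
          have hsub : ∀ (p : u) (j : J p), (c j).1 ∈ ball p.1.1 (3 * p.1.2) := by
            rintro p ⟨j, hj⟩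
            have h1 : ((c j).2 : ℝ) < p.1.2 := by exact_mod_cast (huG p.2).2 j hj
            obtain ⟨z, hz1, hz2⟩ := hj
            rw [mem_ball] at *
            have := dist_triangle_left (c j).1 p.1.1 z
            have := p.1.2.2
            have : (0 : ℝ) ≤ p.1.2 := p.1.2.2
            linarith
          rintro ⟨p, j⟩ ⟨q, k⟩ hjk
          have hjk' : (j : ℕ) = k := hjk
          have hpq : p = q := by
            by_contra hne
            have hdis := hud p.2 q.2 (fun h => hne (Subtype.ext h))
            have h2 := hsub q k
            rw [← hjk'] at h2
            exact Set.disjoint_left.1 hdis (hsub p j) h2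
          subst hpq
          congr 1
          exact Subtype.ext hjk'
  have hcov := Hcap_le_of_countable n d hd (ι := ℕ ⊕ u) (⋃ p ∈ F, ball p.1 (β * p.2))
    (Sum.elim (fun j => (c j).1) (fun p => p.1.1))
    (Sum.elim (fun j => 3 * β * (c j).2) (fun p => 11 * β * p.1.2)) (by
      intro z hz
      simp only [mem_iUnion] at hz
      obtain ⟨p, hp, hz⟩ := hz
      have hp0 : (0 : ℝ) ≤ p.2 := p.2.2
      rw [mem_iUnion]
      by_cases hpG : p ∈ G
      · obtain ⟨q, hq, ⟨w, hw1, hw2⟩, hle⟩ := hu p hpG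
        refine ⟨Sum.inr ⟨q, hq⟩, ?_⟩
        simp only [Sum.elim_inr, mem_ball, NNReal.coe_mul, NNReal.coe_ofNat] at *
        have h1 := dist_triangle z p.1 q.1
        have h2 := dist_triangle_left p.1 q.1 w
        have h3 : (β : ℝ) * p.2 ≤ β * (2 * q.2) := by gcongr
        have h4 : (1 : ℝ) * q.2 ≤ β * q.2 := by gcongr
        linarith
      · have : ∃ j ∈ J p, p.2 ≤ (c j).2 := by
          by_contra! hcon
          exact hpG ⟨hp, hcon⟩
        obtain ⟨j, ⟨w, hw1, hw2⟩, hle⟩ := this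
        refine ⟨Sum.inl j, ?_⟩
        have hle' : (p.2 : ℝ) ≤ (c j).2 := by exact_mod_cast hle
        simp only [Sum.elim_inl, mem_ball, NNReal.coe_mul, NNReal.coe_ofNat] at *
        have h1 := dist_triangle z p.1 (c j).1
        have h2 := dist_triangle_left p.1 (c j).1 w
        have h3 : (β : ℝ) * p.2 ≤ β * (c j).2 := by gcongr
        have h4 : (1 : ℝ) * (c j).2 ≤ β * (c j).2 := by gcongr
        linarith)
  refine hcov.trans ?_
  rw [ENNReal.summable.tsum_sum ENNReal.summable]
  simp only [Sum.elim_inl, Sum.elim_inr, ENNReal.coe_mul, ENNReal.mul_rpow_of_nonneg _ _ hd.le,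
    ENNReal.tsum_mul_left, ENNReal.coe_ofNat]
  rw [add_mul, add_mul]
  gcongr
  · norm_num
  · norm_num

/-- `H^d({N_β ω > λ}) ≤ C β^d H^d({N ω > λ})`, with `C` depending only
on `n` (independent of `β`, `ω`, `λ` and `d`). -/
theorem stmt2 (n : ℕ) (hn : 1 ≤ n) :
    ∃ C : ℝ≥0∞, 0 < C ∧ C ≠ ∞ ∧
      ∀ (d : ℝ), 0 < d → d ≤ (n : ℝ) →
      ∀ (β : ℝ), 1 ≤ β →
      ∀ (lam : ℝ), 0 < lam →
      ∀ ω : EuclideanSpace ℝ (Fin n) → ℝ → ℝ≥0∞, Measurable (Function.uncurry ω) →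
        Hcap n d {x | ENNReal.ofReal lam < ntMaxA n β ω x} ≤
          C * ENNReal.ofReal β ^ d * Hcap n d {x | ENNReal.ofReal lam < ntMax n ω x} := by
  refine ⟨3 ^ (n : ℝ) + 11 ^ (n : ℝ), ?_, ?_, ?_⟩
  · exact lt_of_lt_of_le (ENNReal.rpow_pos (by norm_num) (by norm_num)) le_self_add
  · simp [ENNReal.rpow_natCast]
  intro d hd hdn β hβ lam _ ω _
  lift β to ℝ≥0 using by linarith
  have hβ' : 1 ≤ β := by exact_mod_cast hβ
  have hK0 : (3 ^ (n : ℝ) + 11 ^ (n : ℝ)) * (β : ℝ≥0∞) ^ d ≠ 0 := by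
    have : (β : ℝ≥0∞) ^ d ≠ 0 :=
      (ENNReal.rpow_pos (by exact_mod_cast lt_of_lt_of_le one_pos hβ') ENNReal.coe_ne_top).ne'
    refine mul_ne_zero ?_ this
    simp [ENNReal.rpow_natCast]
  have hKt : (3 ^ (n : ℝ) + 11 ^ (n : ℝ)) * (β : ℝ≥0∞) ^ d ≠ ∞ := by
    refine ENNReal.mul_ne_top ?_ (ENNReal.rpow_ne_top_of_nonneg hd.le ENNReal.coe_ne_top)
    simp [ENNReal.rpow_natCast]
  rw [ENNReal.ofReal_coe_nnreal]
  conv_rhs => rw [Hcap]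
  rw [ENNReal.mul_iInf_of_ne hK0 hKt]
  refine le_iInf fun c => ?_
  rw [ENNReal.mul_iInf_of_ne hK0 hKt]
  refine le_iInf fun hc => ?_
  by_cases hS : ∑' j, ((c j).2 : ℝ≥0∞) ^ d = ∞
  · rw [hS, ENNReal.mul_top hK0]
    exact le_top
  let F : Set (EuclideanSpace ℝ (Fin n) × ℝ≥0) :=
    {p | 0 < p.2 ∧ ENNReal.ofReal lam < ω p.1 p.2}
  have hmain := cover_bound n d hd hdn β hβ' F (fun p hp => hp.1) c (fun p hp => by
    refine Subset.trans ?_ hc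
    intro x hx
    simp only [mem_ofPred_eq, ntMax, lt_iSup_iff]
    exact ⟨p.1, p.2, by exact_mod_cast hp.1, mem_ball'.1 hx, hp.2⟩) hS
  refine le_trans ?_ hmain
  refine iInf_mono fun c' => iInf_mono' fun h => ⟨Subset.trans ?_ h, le_rfl⟩
  intro x hx
  simp only [mem_ofPred_eq, ntMaxA, lt_iSup_iff] at hx
  obtain ⟨y, t, ht, hd', hω⟩ := hx
  lift t to ℝ≥0 using ht.le
  simp only [mem_iUnion]
  exact ⟨(y, t), ⟨by exact_mod_cast ht, hω⟩, mem_ball'.2 hd'⟩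

end
end

section
/- Let d ∈ (0,n] and let Ω be an open subset of ℝⁿ. Define H^d_*(Ω) := inf{∑_{j=1}^∞ r_j^d : Ω ⊆ ∪_{j=1}^∞ B(x_j,r_j) with r_j > dist(x_j, ∂Ω)/10000 for every j}. Then there is a constant C ≥ 1, depending only on n and d, such that H^d(Ω) ≤ H^d_*(Ω) ≤ C·H^d(Ω) for every open Ω ⊆ ℝⁿ. -/
open MeasureTheory Metric Set
open scoped ENNReal NNReal

noncomputable section

/-- The modified Hausdorff capacity `H^d_*(Ω)`, where covering balls are required to have
radius at least `dist(center, ∂Ω)/10000`. -/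
def HcapStar (n : ℕ) (d : ℝ) (Ω : Set (EuclideanSpace ℝ (Fin n))) : ℝ≥0∞ :=
  ⨅ (c : ℕ → EuclideanSpace ℝ (Fin n) × ℝ≥0)
    (_ : Ω ⊆ ⋃ j, ball (c j).1 (c j).2)
    (_ : ∀ j, Metric.infDist (c j).1 (frontier Ω) / 10000 < ((c j).2 : ℝ)),
    ∑' j, ((c j).2 : ℝ≥0∞) ^ d

/-- A countable admissible cover with an arbitrary countable index type bounds `HcapStar`. -/
lemma star_le (n : ℕ) (d : ℝ) (hd0 : 0 < d) (Ω : Set (EuclideanSpace ℝ (Fin n)))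
    {ι : Type} [Countable ι] (c : ι → EuclideanSpace ℝ (Fin n) × ℝ≥0)
    (hcov : Ω ⊆ ⋃ j, ball (c j).1 (c j).2)
    (hc : ∀ j, Metric.infDist (c j).1 (frontier Ω) / 10000 < ((c j).2 : ℝ)) :
    HcapStar n d Ω ≤ ∑' j, ((c j).2 : ℝ≥0∞) ^ d := by
  obtain ⟨p, hp⟩ : ∃ p, Metric.infDist p (frontier Ω) = 0 := by
    rcases (frontier Ω).eq_empty_or_nonempty with h | ⟨p, hp⟩
    · exact ⟨0, by simp [h]⟩
    · exact ⟨p, Metric.infDist_zero_of_mem hp⟩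
  refine ENNReal.le_of_forall_pos_le_add fun ε hε _ => ?_
  obtain ⟨η, hη, hsum⟩ := ENNReal.exists_pos_sum_of_countable (ε := (ε : ℝ≥0∞))
    (by simpa using hε.ne') ℕ
  obtain ⟨hD⟩ := nonempty_denumerable (ι ⊕ ℕ)
  let e : ℕ ≃ ι ⊕ ℕ := (Denumerable.eqv (ι ⊕ ℕ)).symm
  let c' : ι ⊕ ℕ → EuclideanSpace ℝ (Fin n) × ℝ≥0 :=
    Sum.elim c (fun k => (p, (η k) ^ (1 / d)))
  have hsum' : ∑' j, ((c' j).2 : ℝ≥0∞) ^ d ≤ ∑' j, ((c j).2 : ℝ≥0∞) ^ d + ε := by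
    have h1 : ∑' j, ((c' j).2 : ℝ≥0∞) ^ d
        = ∑' j, ((c j).2 : ℝ≥0∞) ^ d + ∑' k, (η k : ℝ≥0∞) := by
      refine HasSum.tsum_eq (HasSum.sum ?_ ?_)
      · exact ENNReal.summable.hasSum
      · have : ((fun j => ((c' j).2 : ℝ≥0∞) ^ d) ∘ Sum.inr) = fun k => (η k : ℝ≥0∞) := by
          funext k
          simp only [Function.comp, c', Sum.elim_inr]
          rw [← ENNReal.coe_rpow_of_nonneg _ hd0.le, ← NNReal.rpow_mul]
          simp [hd0.ne']
        rw [this]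
        exact ENNReal.summable.hasSum
    rw [h1]
    gcongr
  refine le_trans ?_ hsum'
  rw [← e.tsum_eq]
  refine iInf_le_of_le (fun k => c' (e k)) (iInf_le_of_le ?_ (iInf_le_of_le ?_ le_rfl))
  · intro x hx
    obtain ⟨j, hj⟩ := mem_iUnion.1 (hcov hx)
    refine mem_iUnion.2 ⟨e.symm (Sum.inl j), ?_⟩
    simpa [c'] using hj
  · intro k
    change infDist (c' (e k)).1 (frontier Ω) / 10000 < ((c' (e k)).2 : ℝ)
    rcases e k with j | j
    · exact hc j
    · simp only [c', Sum.elim_inr, hp]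
      have : 0 < (η j) ^ (1 / d) := NNReal.rpow_pos (hη j)
      rw [zero_div]
      exact NNReal.coe_pos.2 this

/-- Comparison by volume: disjoint balls covered by smaller balls. -/
lemma bad_sum (n : ℕ) (hn : 1 ≤ n) (d : ℝ) (hd0 : 0 < d) (hdn : d ≤ (n : ℝ))
    {ι κ : Type} [Countable ι] [Countable κ]
    (x : ι → EuclideanSpace ℝ (Fin n)) (r : ι → ℝ≥0)
    (y : κ → EuclideanSpace ℝ (Fin n)) (ρ : κ → ℝ≥0) (hρ : ∀ k, 0 < ρ k)
    (hdisj : Pairwise (Function.onFun Disjoint fun k => ball (y k) (ρ k : ℝ)))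
    (hcov : ∀ k, ball (y k) (ρ k) ⊆ ⋃ j, ball (x j) (r j))
    (hsize : ∀ j k, (ball (x j) (r j : ℝ) ∩ ball (y k) (ρ k)).Nonempty → r j ≤ ρ k) :
    ∑' k, (ρ k : ℝ≥0∞) ^ d ≤ ∑' j, (r j : ℝ≥0∞) ^ d := by
  have : Nonempty (Fin n) := ⟨⟨0, hn⟩⟩
  set v : ℝ≥0∞ := volume (ball (0 : EuclideanSpace ℝ (Fin n)) 1) with hv
  have hv0 : v ≠ 0 := (measure_ball_pos _ _ one_pos).ne'
  have hvt : v ≠ ∞ := measure_ball_lt_top.ne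
  have hvol : ∀ (z : EuclideanSpace ℝ (Fin n)) (s : ℝ≥0),
      volume (ball z (s : ℝ)) = (s : ℝ≥0∞) ^ (n : ℝ) * v := by
    intro z s
    rw [Measure.addHaar_ball volume z s.coe_nonneg, finrank_euclideanSpace_fin]
    congr 1
    rw [ENNReal.rpow_natCast, ENNReal.ofReal_pow s.coe_nonneg]
    simp
  have hexp : ∀ s : ℝ≥0, (s : ℝ≥0∞) ^ (d - n) * (s : ℝ≥0∞) ^ (n : ℝ) ≤ (s : ℝ≥0∞) ^ d := by
    intro s
    rcases eq_or_ne s 0 with rfl | hs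
    · have : (0 : ℝ) < n := by exact_mod_cast hn
      simp [ENNReal.zero_rpow_of_pos this]
    · rw [← ENNReal.rpow_add _ _ (by simpa using hs) (by simp)]
      simp
  have hexp' : ∀ k, (ρ k : ℝ≥0∞) ^ d = (ρ k : ℝ≥0∞) ^ (d - n) * (ρ k : ℝ≥0∞) ^ (n : ℝ) := by
    intro k
    rw [← ENNReal.rpow_add _ _ (by simpa using (hρ k).ne') (by simp)]
    simp
  rw [← ENNReal.mul_le_mul_iff_left hv0 hvt, ← ENNReal.tsum_mul_right, ← ENNReal.tsum_mul_right]
  calc ∑' k, (ρ k : ℝ≥0∞) ^ d * v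
      ≤ ∑' k, ∑' j, (r j : ℝ≥0∞) ^ (d - n) * volume (ball (x j) (r j) ∩ ball (y k) (ρ k)) := by
        refine ENNReal.tsum_le_tsum fun k => ?_
        rw [hexp', mul_assoc, ← hvol (y k)]
        have h1 : volume (ball (y k) (ρ k : ℝ))
            ≤ ∑' j, volume (ball (x j) (r j : ℝ) ∩ ball (y k) (ρ k)) := by
          refine le_trans (measure_mono ?_) (measure_iUnion_le _)
          intro z hz
          obtain ⟨j, hj⟩ := mem_iUnion.1 (hcov k hz)
          exact mem_iUnion.2 ⟨j, hj, hz⟩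
        refine le_trans (mul_le_mul_right h1 _) ?_
        rw [← ENNReal.tsum_mul_left]
        refine ENNReal.tsum_le_tsum fun j => ?_
        rcases (ball (x j) (r j : ℝ) ∩ ball (y k) (ρ k)).eq_empty_or_nonempty with h | h
        · simp [h]
        · refine mul_le_mul_left ?_ _
          have h2 := hsize j k h
          have h3 : d - n = -(n - d) := by ring
          rw [h3, ENNReal.rpow_neg, ENNReal.rpow_neg, ENNReal.inv_le_inv]
          exact ENNReal.rpow_le_rpow (by exact_mod_cast h2) (by linarith)
    _ = ∑' j, (r j : ℝ≥0∞) ^ (d - n) * ∑' k, volume (ball (x j) (r j) ∩ ball (y k) (ρ k)) := by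
        rw [ENNReal.tsum_comm]
        simp_rw [ENNReal.tsum_mul_left]
    _ ≤ ∑' j, (r j : ℝ≥0∞) ^ d * v := by
        refine ENNReal.tsum_le_tsum fun j => ?_
        have h1 : ∑' k, volume (ball (x j) (r j : ℝ) ∩ ball (y k) (ρ k))
            ≤ volume (ball (x j) (r j : ℝ)) := by
          rw [← measure_iUnion]
          · exact measure_mono (iUnion_subset fun k => inter_subset_left)
          · intro a b hab
            exact (hdisj hab).mono inter_subset_right inter_subset_right
          · intro k
            exact measurableSet_ball.inter measurableSet_ball
        refine le_trans (mul_le_mul_right h1 _) ?_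
        rw [hvol, ← mul_assoc]
        exact mul_le_mul_left (hexp _) _

/-- Whitney-type maximal disjoint family. -/
lemma whitney {E : Type*} [PseudoMetricSpace E] (Ω : Set E) (ρ : E → ℝ)
    (hpos : ∀ y ∈ Ω, 0 < ρ y) (hlip : ∀ y z, ρ y ≤ ρ z + dist y z / 1000) :
    ∃ S ⊆ Ω, S.PairwiseDisjoint (fun y => ball y (ρ y)) ∧
      ∀ y ∈ Ω, ∃ s ∈ S, y ∈ ball s (5 * ρ s) := by
  obtain ⟨S, hS⟩ := zorn_subset {S : Set E | S ⊆ Ω ∧ S.PairwiseDisjoint (fun y => ball y (ρ y))} (by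
    intro c hc hch
    refine ⟨⋃₀ c, ⟨sUnion_subset fun s hs => (hc hs).1, ?_⟩, fun s hs => subset_sUnion_of_mem hs⟩
    exact (pairwiseDisjoint_sUnion hch.directedOn).2 fun s hs => (hc hs).2)
  refine ⟨S, hS.prop.1, hS.prop.2, fun y hy => ?_⟩
  by_contra! hcon
  have hyS : y ∉ S := fun h => hcon y h (mem_ball_self (by linarith [hpos y hy]))
  have : insert y S ⊆ S := hS.2 (y := insert y S) ⟨insert_subset hy hS.prop.1, by
    refine hS.prop.2.insert fun s hs _ => ?_
    refine Set.disjoint_left.2 fun z hz1 hz2 => hcon s hs ?_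
    rw [mem_ball] at *
    have h1 := hlip y s
    have h2 := hpos s (hS.prop.1 hs)
    have h3 := dist_triangle_left y s z
    linarith⟩ (subset_insert _ _)
  exact hyS (this (mem_insert _ _))

/-- A ball around a point of `Ω` of radius at most the distance to the boundary stays in `Ω`. -/
lemma whitney_ball_sub {n : ℕ} {Ω : Set (EuclideanSpace ℝ (Fin n))} (hΩ : IsOpen Ω)
    {y : EuclideanSpace ℝ (Fin n)} (hy : y ∈ Ω) {s : ℝ} (hs0 : 0 < s)
    (hs : s ≤ infDist y (frontier Ω)) : ball y s ⊆ Ω := by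
  refine (convex_ball y s).isPreconnected.subset_of_closure_inter_subset hΩ
    ⟨y, mem_ball_self hs0, hy⟩ ?_
  rintro z ⟨hz1, hz2⟩
  by_contra hz
  have hf : z ∈ frontier Ω := by
    rw [hΩ.frontier_eq]
    exact ⟨hz1, hz⟩
  have := infDist_le_dist_of_mem (x := y) hf
  rw [mem_ball, dist_comm] at hz2
  linarith

lemma key (n : ℕ) (hn : 1 ≤ n) (d : ℝ) (hd0 : 0 < d) (hdn : d ≤ (n : ℝ))
    (Ω : Set (EuclideanSpace ℝ (Fin n))) (hΩ : IsOpen Ω)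
    (c : ℕ → EuclideanSpace ℝ (Fin n) × ℝ≥0) (hcov : Ω ⊆ ⋃ j, ball (c j).1 (c j).2) :
    HcapStar n d Ω ≤ ((100 : ℝ≥0∞) ^ d + (5 : ℝ≥0∞) ^ d) * ∑' j, ((c j).2 : ℝ≥0∞) ^ d := by
  have hone : (1 : ℝ≥0∞) ≤ (100 : ℝ≥0∞) ^ d := ENNReal.one_le_rpow (by norm_num) hd0
  rcases (frontier Ω).eq_empty_or_nonempty with hfr | hfr
  · have h1 := star_le n d hd0 Ω (fun j : {j : ℕ // 0 < (c j).2} => c j) (by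
      intro x hx
      obtain ⟨j, hj⟩ := mem_iUnion.1 (hcov hx)
      have : 0 < (c j).2 := by
        have := pos_of_mem_ball hj
        exact_mod_cast this
      exact mem_iUnion.2 ⟨⟨j, this⟩, hj⟩) (by
      intro j
      have := j.2
      simpa [hfr] using this)
    refine h1.trans ((ENNReal.tsum_comp_le_tsum_of_injective Subtype.val_injective
      (fun j => ((c j).2 : ℝ≥0∞) ^ d)).trans ?_)
    exact le_mul_of_one_le_left (zero_le) (hone.trans le_self_add)
  set δ : EuclideanSpace ℝ (Fin n) → ℝ := fun y => infDist y (frontier Ω) with hδ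
  have hδlip : ∀ y z, δ y ≤ δ z + dist y z := fun y z => infDist_le_infDist_add_dist
  have hδnn : ∀ y, 0 ≤ δ y := fun y => infDist_nonneg
  have hδpos : ∀ y ∈ Ω, 0 < δ y := by
    intro y hy
    refine (isClosed_frontier.notMem_iff_infDist_pos hfr).1 fun h => ?_
    exact Set.disjoint_left.1 (disjoint_frontier_iff_isOpen.2 hΩ) h hy
  let ρ : EuclideanSpace ℝ (Fin n) → ℝ≥0 := fun y => ⟨δ y / 1000, by have := hδnn y; positivity⟩
  have hρ : ∀ y, ((ρ y : ℝ≥0) : ℝ) = δ y / 1000 := fun y => rfl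
  obtain ⟨S, hSΩ, hSd, hScov⟩ := whitney Ω (fun y => (ρ y : ℝ))
    (fun y hy => by have := hδpos y hy; simp only [hρ]; positivity)
    (fun y z => by have := hδlip y z; simp only [hρ]; linarith)
  have hSc : S.Countable := hSd.countable_of_isOpen (fun _ _ => isOpen_ball)
    (fun y hy => ⟨y, mem_ball_self (by
      have := hδpos y (hSΩ hy); simp only [hρ]; positivity)⟩)
  let G : ℕ → Prop := fun j => δ (c j).1 / 10000 < (c j).2
  let T : Set (EuclideanSpace ℝ (Fin n)) :=
    {y | y ∈ S ∧ ∀ j, G j → ball (c j).1 ((c j).2 : ℝ) ∩ ball y (ρ y) = ∅}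
  have hTS : T ⊆ S := fun y hy => hy.1
  have : Countable T := (hSc.mono hTS).to_subtype
  have hbad : ∑' y : T, (ρ y : ℝ≥0∞) ^ d ≤ ∑' j : {j // ¬ G j}, ((c j).2 : ℝ≥0∞) ^ d := by
    refine bad_sum n hn d hd0 hdn (fun j : {j // ¬ G j} => (c j).1) (fun j => (c j).2)
      (fun y : T => (y : EuclideanSpace ℝ (Fin n))) (fun y => ρ y) ?_ ?_ ?_ ?_
    · intro y
      have := hδpos y (hSΩ (hTS y.2))
      rw [← NNReal.coe_pos, hρ]
      positivity
    · intro a b hab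
      exact hSd (hTS a.2) (hTS b.2) (fun h => hab (Subtype.ext h))
    · intro y z hz
      have hy := hδpos y (hSΩ (hTS y.2))
      have hz' : z ∈ Ω := whitney_ball_sub hΩ (hSΩ (hTS y.2)) (s := ρ y) (by rw [hρ]; positivity)
        (by rw [hρ]; change _ ≤ δ y; linarith) hz
      obtain ⟨j, hj⟩ := mem_iUnion.1 (hcov hz')
      refine mem_iUnion.2 ⟨⟨j, fun hG => ?_⟩, hj⟩
      have := y.2.2 j hG
      exact (this ▸ (⟨hj, hz⟩ : z ∈ ball (c j).1 ((c j).2 : ℝ) ∩ ball (y : EuclideanSpace ℝ (Fin n)) (ρ y)) : z ∈ (∅ : Set _))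
    · rintro ⟨j, hj⟩ y ⟨z, hz1, hz2⟩
      have hj' := not_lt.1 hj
      rw [mem_ball] at hz1 hz2
      rw [hρ] at hz2
      have h1 := hδlip (c j).1 y
      have h2 := dist_triangle_left (c j).1 (y : EuclideanSpace ℝ (Fin n)) z
      rw [← NNReal.coe_le_coe, hρ]
      simp only at *
      have := hδnn y
      linarith
  let c' : {j // G j} ⊕ T → EuclideanSpace ℝ (Fin n) × ℝ≥0 :=
    Sum.elim (fun j => ((c j).1, 100 * (c j).2)) (fun y => ((y : EuclideanSpace ℝ (Fin n)), 5 * ρ y))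
  have hstar := star_le n d hd0 Ω c' (by
    intro x hx
    obtain ⟨s, hs, hxs⟩ := hScov x hx
    by_cases hsT : s ∈ T
    · exact mem_iUnion.2 ⟨Sum.inr ⟨s, hsT⟩, by simpa [c'] using hxs⟩
    · have : ∃ j, G j ∧ (ball (c j).1 ((c j).2 : ℝ) ∩ ball s (ρ s)).Nonempty := by
        by_contra! hcon
        exact hsT ⟨hs, hcon⟩
      obtain ⟨j, hj, z, hz1, hz2⟩ := this
      refine mem_iUnion.2 ⟨Sum.inl ⟨j, hj⟩, ?_⟩
      have hj' : δ (c j).1 / 10000 < (c j).2 := hj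
      simp only [c', Sum.elim_inl, NNReal.coe_mul, NNReal.coe_ofNat]
      rw [mem_ball] at *
      simp only [hρ] at *
      have h1 := hδlip s (c j).1
      have h2 := dist_triangle_left s (c j).1 z
      have h3 := dist_triangle x s (c j).1
      linarith) (by
    rintro (⟨j, hj⟩ | y)
    · have hj' : δ (c j).1 / 10000 < (c j).2 := hj
      change δ (c j).1 / 10000 < ((100 * (c j).2 : ℝ≥0) : ℝ)
      have := (c j).2.2
      push_cast
      linarith [NNReal.coe_nonneg (c j).2]
    · have := hδpos y (hSΩ (hTS y.2))
      change δ y / 10000 < ((5 * ρ y : ℝ≥0) : ℝ)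
      push_cast
      rw [hρ]
      linarith)
  refine hstar.trans ?_
  have hsum : ∑' j, ((c' j).2 : ℝ≥0∞) ^ d
      = ∑' j : {j // G j}, ((100 * (c j).2 : ℝ≥0) : ℝ≥0∞) ^ d
        + ∑' y : T, ((5 * ρ y : ℝ≥0) : ℝ≥0∞) ^ d :=
    HasSum.tsum_eq (HasSum.sum ENNReal.summable.hasSum ENNReal.summable.hasSum)
  rw [hsum, add_mul]
  simp only [ENNReal.coe_mul, ENNReal.mul_rpow_of_nonneg _ _ hd0.le, ENNReal.tsum_mul_left,
    ENNReal.coe_ofNat]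
  gcongr
  · exact ENNReal.tsum_comp_le_tsum_of_injective Subtype.val_injective
      (fun j => ((c j).2 : ℝ≥0∞) ^ d)
  · exact hbad.trans (ENNReal.tsum_comp_le_tsum_of_injective Subtype.val_injective
      (fun j => ((c j).2 : ℝ≥0∞) ^ d))

/-- For every open `Ω ⊆ ℝⁿ`, `H^d(Ω) ≤ H^d_*(Ω) ≤ C H^d(Ω)`, with `C ≥ 1`
depending only on `n` and `d`. -/
theorem stmt4 (n : ℕ) (hn : 1 ≤ n) (d : ℝ) (hd0 : 0 < d) (hdn : d ≤ (n : ℝ)) :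
    ∃ C : ℝ≥0∞, 1 ≤ C ∧ C ≠ ∞ ∧
      ∀ Ω : Set (EuclideanSpace ℝ (Fin n)), IsOpen Ω →
        Hcap n d Ω ≤ HcapStar n d Ω ∧ HcapStar n d Ω ≤ C * Hcap n d Ω := by
  refine ⟨(100 : ℝ≥0∞) ^ d + (5 : ℝ≥0∞) ^ d, ?_, ?_, fun Ω hΩ => ⟨?_, ?_⟩⟩
  · exact (ENNReal.one_le_rpow (by norm_num) hd0).trans le_self_add
  · exact ENNReal.add_ne_top.2 ⟨ENNReal.rpow_ne_top_of_nonneg hd0.le (by norm_num),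
      ENNReal.rpow_ne_top_of_nonneg hd0.le (by norm_num)⟩
  · exact le_iInf fun c => le_iInf fun hc => le_iInf fun _ => iInf_le_of_le c (iInf_le _ hc)
  · unfold Hcap
    have hC : (100 : ℝ≥0∞) ^ d + (5 : ℝ≥0∞) ^ d ≠ ∞ :=
      ENNReal.add_ne_top.2 ⟨ENNReal.rpow_ne_top_of_nonneg hd0.le (by norm_num),
        ENNReal.rpow_ne_top_of_nonneg hd0.le (by norm_num)⟩
    have hC0 : (100 : ℝ≥0∞) ^ d + (5 : ℝ≥0∞) ^ d ≠ 0 :=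
      (zero_lt_one.trans_le ((ENNReal.one_le_rpow (by norm_num) hd0).trans le_self_add)).ne'
    simp only [ENNReal.mul_iInf_of_ne hC0 hC]
    exact le_iInf fun c => le_iInf fun hc => key n hn d hd0 hdn Ω hΩ c hc

end
end

section
/- Let n ≥ 1, τ > 0, and 0 < a ≤ b ≤ 1/τ. For every nonnegative measurable function ω on ℝⁿ×(0,∞): if ∫_{ℝⁿ} [Nω(x)]^a dH^{nτa}(x) < ∞, then ∫_{ℝⁿ} [Nω(x)]^b dH^{nτb}(x) < ∞ (Choquet integrals against Hausdorff capacities). -/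
open MeasureTheory Metric Set
open scoped ENNReal NNReal

noncomputable section

lemma rpow_split (x : ℝ≥0∞) {p : ℝ} (hp : 1 ≤ p) : x ^ p = x * x ^ (p - 1) := by
  have h := ENNReal.rpow_add_of_nonneg (x := x) 1 (p - 1) zero_le_one (by linarith)
  rw [ENNReal.rpow_one] at h
  rw [← h]; congr 1; ring

lemma tsum_rpow_le_aux (f : ℕ → ℝ≥0∞) {p : ℝ} (hp : 1 ≤ p) :
    ∑' j, f j ^ p ≤ (∑' j, f j) ^ p := by
  rw [rpow_split _ hp, ← ENNReal.tsum_mul_right]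
  refine ENNReal.tsum_le_tsum fun j => ?_
  rw [rpow_split _ hp]
  gcongr
  · exact ENNReal.le_tsum j

lemma Hcap_le_rpow (n : ℕ) (d p : ℝ) (hp : 1 ≤ p) (E : Set (EuclideanSpace ℝ (Fin n))) :
    Hcap n (d * p) E ≤ Hcap n d E ^ p := by
  have hp0 : 0 < p := by linarith
  rw [← ENNReal.rpow_inv_le_iff hp0]
  unfold Hcap
  refine le_iInf₂ fun c hc => ?_
  rw [ENNReal.rpow_inv_le_iff hp0]
  refine (iInf₂_le c hc).trans ?_
  simp_rw [ENNReal.rpow_mul]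
  exact tsum_rpow_le_aux _ hp

lemma Hcap_mono (n : ℕ) (d : ℝ) {E F : Set (EuclideanSpace ℝ (Fin n))} (h : E ⊆ F) :
    Hcap n d E ≤ Hcap n d F := by
  unfold Hcap
  exact le_iInf₂ fun c hc => iInf₂_le c (h.trans hc)

lemma choquet_rpow_lt_top (n : ℕ) (d p : ℝ) (hp : 1 ≤ p)
    (f : EuclideanSpace ℝ (Fin n) → ℝ≥0∞) (h : choquet n d f < ∞) :
    choquet n (d * p) (fun x => f x ^ p) < ∞ := by
  have hp0 : 0 < p := by linarith
  set F : ℝ → ℝ≥0∞ := fun s => Hcap n d {x | ENNReal.ofReal s < f x} with hF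
  set I := choquet n d f with hI
  have hanti : Antitone F := fun s t hst => Hcap_mono n d fun x hx =>
    lt_of_le_of_lt (ENNReal.ofReal_le_ofReal hst) hx
  have hweak : ∀ s : ℝ, 0 < s → ENNReal.ofReal s * F s ≤ I := by
    intro s hs
    calc ENNReal.ofReal s * F s = ∫⁻ _ in Ioo (0:ℝ) s, F s := by
          rw [setLIntegral_const, Real.volume_Ioo, sub_zero, mul_comm]
      _ ≤ ∫⁻ t in Ioo (0:ℝ) s, F t :=
          setLIntegral_mono' measurableSet_Ioo fun t ht => hanti ht.2.le
      _ ≤ I := lintegral_mono_set Ioo_subset_Ioi_self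
  have himg : (fun s : ℝ => s ^ p) '' Ioi 0 = Ioi 0 := by
    ext y
    constructor
    · rintro ⟨x, hx, rfl⟩
      exact Real.rpow_pos_of_pos hx p
    · intro hy
      exact ⟨y ^ p⁻¹, Real.rpow_pos_of_pos hy _, Real.rpow_inv_rpow (le_of_lt hy) hp0.ne'⟩
  have hC : ENNReal.ofReal p * I ^ (p - 1) ≠ ∞ :=
    ENNReal.mul_ne_top ENNReal.ofReal_ne_top
      (ENNReal.rpow_ne_top_of_nonneg (by linarith) h.ne)
  have key : choquet n (d * p) (fun x => f x ^ p) ≤ ENNReal.ofReal p * I ^ (p - 1) * I := by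
    unfold choquet
    rw [← himg, lintegral_image_eq_lintegral_abs_deriv_mul (f' := fun s => p * s ^ (p - 1))
      measurableSet_Ioi
      (fun x hx => (Real.hasDerivAt_rpow_const (Or.inl (ne_of_gt hx))).hasDerivWithinAt)
      (fun x hx y hy hxy => (Real.rpow_left_inj (le_of_lt hx) (le_of_lt hy) hp0.ne').1 hxy)]
    have : ENNReal.ofReal p * I ^ (p - 1) * I
        = ∫⁻ s in Ioi (0:ℝ), ENNReal.ofReal p * I ^ (p - 1) * F s := by
      rw [lintegral_const_mul' _ _ hC]
      rfl
    rw [this]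
    refine setLIntegral_mono' measurableSet_Ioi fun s hs => ?_
    have hs : 0 < s := hs
    have hset : {x | ENNReal.ofReal (s ^ p) < f x ^ p} = {x | ENNReal.ofReal s < f x} := by
      ext x
      simp only [mem_ofPred_eq]
      rw [← ENNReal.ofReal_rpow_of_pos hs, ENNReal.rpow_lt_rpow_iff hp0]
    rw [hset, abs_of_pos (by positivity), ENNReal.ofReal_mul hp0.le,
      ← ENNReal.ofReal_rpow_of_pos hs]
    calc ENNReal.ofReal p * ENNReal.ofReal s ^ (p - 1)
            * Hcap n (d * p) {x | ENNReal.ofReal s < f x}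
        ≤ ENNReal.ofReal p * ENNReal.ofReal s ^ (p - 1) * F s ^ p := by
          gcongr
          exact Hcap_le_rpow n d p hp _
      _ = ENNReal.ofReal p * (ENNReal.ofReal s * F s) ^ (p - 1) * F s := by
          rw [rpow_split (F s) hp, ENNReal.mul_rpow_of_nonneg _ _ (by linarith : 0 ≤ p - 1)]
          ring
      _ ≤ ENNReal.ofReal p * I ^ (p - 1) * F s := by
          gcongr
          · exact hweak s hs
  exact key.trans_lt (ENNReal.mul_lt_top hC.lt_top h)

/-- If `0 < a ≤ b ≤ 1/τ` and `∫ (Nω)^a dH^{nτa} < ∞`, then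
`∫ (Nω)^b dH^{nτb} < ∞`. -/
theorem stmt5 (n : ℕ) (hn : 1 ≤ n) (τ a b : ℝ) (hτ : 0 < τ)
    (ha : 0 < a) (hab : a ≤ b) (hb : b ≤ 1 / τ)
    (ω : EuclideanSpace ℝ (Fin n) → ℝ → ℝ≥0∞) (hω : Measurable (Function.uncurry ω))
    (h : choquet n ((n : ℝ) * τ * a) (fun x => ntMax n ω x ^ a) < ∞) :
    choquet n ((n : ℝ) * τ * b) (fun x => ntMax n ω x ^ b) < ∞ := by
  have hp : 1 ≤ b / a := (one_le_div ha).2 hab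
  have := choquet_rpow_lt_top n _ (b / a) hp _ h
  have e : a * (b / a) = b := by field_simp
  simp_rw [← ENNReal.rpow_mul, mul_assoc, e] at this
  simpa only [mul_assoc] using this

end
end
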